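/- arXiv:2202.04792 — 2 statements merged into one kernel-verified Lean document; each statement's English description precedes it below -/
import Mathlib

section
/- Let R be a commutative Noetherian local ring and M a finitely generated R-module with M ≅ Ω²M that is locally free on the punctured spectrum. Define θ(M,N) = length(Tor_{2n}^R(M,N)) − length(Tor_{2n−1}^R(M,N)) for any n ≥ 1. Then θ(M,N) is well-defined (independent of n), and for every short exact sequence 0 → X → Y → Z → 0 of finitely generated R-modules, θ(M,Y) = θ(M,X) + θ(M,Z). -/
open CategoryTheory IsLocalRing

noncomputable section

variable (R : Type) [CommRing R]

/-- `Tor_i^R(M,N)` as a type. -/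
abbrev TorM (i : ℕ) (M N : Type) [AddCommGroup M] [Module R M]
    [AddCommGroup N] [Module R N] : Type :=
  ((Tor (ModuleCat R) i).obj (ModuleCat.of R M)).obj (ModuleCat.of R N)

/-- `Ext^i_R(M,N)` as a type. -/
abbrev ExtM (i : ℕ) (M N : Type) [AddCommGroup M] [Module R M]
    [AddCommGroup N] [Module R N] : Type :=
  ((Ext R (ModuleCat R) i).obj (Opposite.op (ModuleCat.of R M))).obj (ModuleCat.of R N)

/-- `M` is isomorphic to its `q`-th syzygy `Ω^q M` in a minimal free resolution. -/
def IsPeriodicSyzygy [IsLocalRing R] (M : Type) [AddCommGroup M] [Module R M]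
    (q : ℕ) : Prop :=
  ∃ (n : ℕ → ℕ) (d : ∀ i : ℕ, ((Fin (n (i + 1)) → R) →ₗ[R] (Fin (n i) → R)))
    (g : (Fin (n 0) → R) →ₗ[R] M),
    Function.Surjective g ∧
    LinearMap.ker g = LinearMap.range (d 0) ∧
    (∀ i, LinearMap.ker (d i) = LinearMap.range (d (i + 1))) ∧
    LinearMap.ker g ≤ (maximalIdeal R) • (⊤ : Submodule R (Fin (n 0) → R)) ∧
    (∀ i, LinearMap.range (d i) ≤ (maximalIdeal R) • (⊤ : Submodule R (Fin (n i) → R))) ∧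
    Nonempty (M ≃ₗ[R] LinearMap.range (d (q - 1)))

/-- `M` is locally free on the punctured spectrum of the local ring `R`. -/
def LocFreePunctured [IsLocalRing R] (M : Type) [AddCommGroup M] [Module R M] : Prop :=
  ∀ (p : Ideal R) (_ : p.IsPrime), p ≠ maximalIdeal R →
    Module.Free (Localization.AtPrime p) (LocalizedModule p.primeCompl M)

/-- index type parametrizing all finitely generated `R`-modules (via presentations) -/
abbrev FGIdx := Σ n : ℕ, Submodule R (Fin n → R)

abbrev idxMod (x : FGIdx R) : Type := (Fin x.1 → R) ⧸ x.2

/-- relations (from short exact sequences) defining the Grothendieck group, ℚ-coefficients -/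
def gRelQ : Set (FGIdx R →₀ ℚ) :=
  { v | ∃ (x y z : FGIdx R) (f : idxMod R x →ₗ[R] idxMod R y)
      (g : idxMod R y →ₗ[R] idxMod R z),
      Function.Injective f ∧ Function.Surjective g ∧
      LinearMap.range f = LinearMap.ker g ∧
      v = Finsupp.single y 1 - Finsupp.single x 1 - Finsupp.single z 1 }

/-- relations defining the reduced Grothendieck group with ℚ-coefficients:
SES relations together with the class of `R` itself. -/
def gRelQbar : Set (FGIdx R →₀ ℚ) :=
  gRelQ R ∪ { v | ∃ x : FGIdx R, Nonempty (idxMod R x ≃ₗ[R] R) ∧ v = Finsupp.single x 1 }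

/-- The reduced Grothendieck group with rational coefficients `Ḡ(R)_ℚ`. -/
abbrev GbarQ : Type := (FGIdx R →₀ ℚ) ⧸ Submodule.span ℚ (gRelQbar R)

/-- `[N] = 0` in the reduced Grothendieck group with rational coefficients. -/
def ClassZeroQ (N : Type) [AddCommGroup N] [Module R N] : Prop :=
  ∀ x : FGIdx R, Nonempty (idxMod R x ≃ₗ[R] N) →
    (Submodule.Quotient.mk (p := Submodule.span ℚ (gRelQbar R))
      (Finsupp.single x 1) : GbarQ R) = 0

/-- relations (from short exact sequences) defining the Grothendieck group `G(R)` -/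
def gRelZ : Set (FGIdx R →₀ ℤ) :=
  { v | ∃ (x y z : FGIdx R) (f : idxMod R x →ₗ[R] idxMod R y)
      (g : idxMod R y →ₗ[R] idxMod R z),
      Function.Injective f ∧ Function.Surjective g ∧
      LinearMap.range f = LinearMap.ker g ∧
      v = Finsupp.single y 1 - Finsupp.single x 1 - Finsupp.single z 1 }

/-- The Grothendieck group `G(R)` of finitely generated `R`-modules. -/
abbrev GZ : Type := (FGIdx R →₀ ℤ) ⧸ Submodule.span ℤ (gRelZ R)

open Classical in
noncomputable def gcl (N : Type) [AddCommGroup N] [Module R N] : GZ R :=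
  if h : ∃ x : FGIdx R, Nonempty (idxMod R x ≃ₗ[R] N) then
    Submodule.Quotient.mk (p := Submodule.span ℤ (gRelZ R)) (Finsupp.single h.choose 1)
  else 0

/-- `[N] = 0` in the Grothendieck group `G(R)`. -/
def ClassZeroZ (N : Type) [AddCommGroup N] [Module R N] : Prop :=
  ∀ x : FGIdx R, Nonempty (idxMod R x ≃ₗ[R] N) →
    (Submodule.Quotient.mk (p := Submodule.span ℤ (gRelZ R))
      (Finsupp.single x 1) : GZ R) = 0

/-- the residue field of a local ring, as an `R`-module -/
abbrev resF [IsLocalRing R] : Type := R ⧸ (maximalIdeal R)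

/-- `R` is a Gorenstein local ring of Krull dimension `d`
(characterized by `Ext^i_R(k,R) = 0` for `i ≠ d` and `Ext^d_R(k,R) ≅ k`). -/
def IsGorensteinOfDim [IsLocalRing R] (d : ℕ) : Prop :=
  ringKrullDim R = d ∧
  (∀ i : ℕ, i ≠ d → Subsingleton (ExtM R i (resF R) R)) ∧
  Nonempty ((ExtM R d (resF R) R) ≃ₗ[R] resF R)

/-- `R` is a Cohen-Macaulay local ring of Krull dimension `d` (depth R = dim R = d,
depth computed via `Ext^i(k,R)`). -/
def IsCMOfDim [IsLocalRing R] (d : ℕ) : Prop :=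
  ringKrullDim R = d ∧
  (∀ i : ℕ, i < d → Subsingleton (ExtM R i (resF R) R)) ∧
  Nontrivial (ExtM R d (resF R) R)

/-- `ω` is a canonical module of the `d`-dimensional Cohen-Macaulay local ring `R`. -/
def IsCanonicalModule [IsLocalRing R] (d : ℕ) (ω : Type) [AddCommGroup ω] [Module R ω] : Prop :=
  Module.Finite R ω ∧
  (∀ i : ℕ, i ≠ d → Subsingleton (ExtM R i (resF R) ω)) ∧
  Nonempty ((ExtM R d (resF R) ω) ≃ₗ[R] resF R)

/-- `M` has depth `d` and is maximal Cohen-Macaulay over the `d`-dimensional local ring `R`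
(depth computed via `Ext^i(k,M)`). -/
def IsMCM [IsLocalRing R] (d : ℕ) (M : Type) [AddCommGroup M] [Module R M] : Prop :=
  (∀ i : ℕ, i < d → Subsingleton (ExtM R i (resF R) M)) ∧
  Nontrivial (ExtM R d (resF R) M)

/-- `M` has a free resolution of length at most `k` (so `pd_R M ≤ k`). -/
def PdLE (M : Type) [AddCommGroup M] [Module R M] (k : ℕ) : Prop :=
  ∃ (n : ℕ → ℕ) (d : ∀ i : ℕ, ((Fin (n (i + 1)) → R) →ₗ[R] (Fin (n i) → R)))
    (g : (Fin (n 0) → R) →ₗ[R] M),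
    Function.Surjective g ∧
    LinearMap.ker g = LinearMap.range (d 0) ∧
    (∀ i, LinearMap.ker (d i) = LinearMap.range (d (i + 1))) ∧
    (∀ i, k < i → n i = 0)

/-- `G` is a totally reflexive `R`-module. -/
def IsTotallyReflexive (G : Type) [AddCommGroup G] [Module R G] : Prop :=
  Module.Finite R G ∧
  Function.Bijective (Module.Dual.eval R G) ∧
  (∀ i : ℕ, 1 ≤ i → Subsingleton (ExtM R i G R)) ∧
  (∀ i : ℕ, 1 ≤ i → Subsingleton (ExtM R i (Module.Dual R G) R))

/-- `M` has a resolution by totally reflexive modules of length at most `g`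
(so `Gdim_R M ≤ g`). -/
def GdimLE (M : Type) [AddCommGroup M] [Module R M] (g : ℕ) : Prop :=
  ∃ (G : ℕ → ModuleCat R) (d : ∀ i : ℕ, ((G (i + 1) : Type) →ₗ[R] (G i : Type)))
    (ε : (G 0 : Type) →ₗ[R] M),
    (∀ i, IsTotallyReflexive R (G i)) ∧
    Function.Surjective ε ∧
    LinearMap.ker ε = LinearMap.range (d 0) ∧
    (∀ i, LinearMap.ker (d i) = LinearMap.range (d (i + 1))) ∧
    (∀ i, g < i → Subsingleton (G i : Type))

open Classical in
noncomputable def mlen (M : Type) [AddCommGroup M] [Module R M] : ℕ :=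
  if h : ∃ s : CompositionSeries (Submodule R M), s.head = ⊥ ∧ s.last = ⊤ then
    h.choose.length
  else 0

/-- Hochster's theta invariant `θ(M,N)` computed using `Tor_{2n}` and `Tor_{2n-1}`. -/
noncomputable def theta (M N : Type) [AddCommGroup M] [Module R M]
    [AddCommGroup N] [Module R N] (n : ℕ) : ℤ :=
  (mlen R (TorM R (2 * n) M N) : ℤ) - (mlen R (TorM R (2 * n - 1) M N) : ℤ)

/-- `C` has rank `r`: localization at every associated prime of `R` is free of rank `r`. -/
def HasRankN (C : Type) [AddCommGroup C] [Module R C] (r : ℕ) : Prop :=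
  ∀ (p : Ideal R) (_ : p.IsPrime), p ∈ associatedPrimes R R →
    Nonempty ((LocalizedModule p.primeCompl C) ≃ₗ[Localization.AtPrime p]
      (Fin r → Localization.AtPrime p))

end



section TorPart
open CategoryTheory.Limits CategoryTheory.MonoidalCategory

variable {R : Type} [CommRing R]

/-- the complex `A ⊗ P` -/
abbrev tcx (P : ChainComplex (ModuleCat R) ℕ) (A : ModuleCat R) : ChainComplex (ModuleCat R) ℕ :=
  (((tensoringLeft (ModuleCat R)).obj A).mapHomologicalComplex _).obj P

abbrev tcxMap (P : ChainComplex (ModuleCat R) ℕ) {A B : ModuleCat R} (f : A ⟶ B) :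
    tcx P A ⟶ tcx P B :=
  (NatTrans.mapHomologicalComplex ((tensoringLeft (ModuleCat R)).map f) _).app P

/-- the short complex of complexes obtained from a short complex of modules -/
abbrev tses (P : ChainComplex (ModuleCat R) ℕ) (S : ShortComplex (ModuleCat R)) :
    ShortComplex (ChainComplex (ModuleCat R) ℕ) where
  X₁ := tcx P S.X₁
  X₂ := tcx P S.X₂
  X₃ := tcx P S.X₃
  f := tcxMap P S.f
  g := tcxMap P S.g
  zero := by
    ext i : 1
    change S.f ▷ P.X i ≫ S.g ▷ P.X i = 0
    rw [← comp_whiskerRight, S.zero, MonoidalPreadditive.zero_whiskerRight]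

lemma tses_shortExact (P : ChainComplex (ModuleCat R) ℕ) [∀ i, Projective (P.X i)]
    (S : ShortComplex (ModuleCat R)) (hS : S.ShortExact) : (tses P S).ShortExact := by
  apply HomologicalComplex.shortExact_of_degreewise_shortExact
  intro i
  have : Module.Projective R (P.X i) := (IsProjective.iff_projective (P.X i)).mpr inferInstance
  have hex := (ShortComplex.ShortExact.moduleCat_exact_iff_function_exact _).mp hS.exact
  apply ModuleCat.shortComplex_shortExact
  · exact _root_.rTensor_exact (P.X i) hex hS.moduleCat_surjective_g
  · exact Module.Flat.rTensor_preserves_injective_linearMap (M := P.X i) S.f.hom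
      hS.moduleCat_injective_f
  · exact LinearMap.rTensor_surjective (P.X i) (g := S.g.hom) hS.moduleCat_surjective_g

lemma tcx_homology_zero {N : ModuleCat R} (P : ProjectiveResolution N) (F : ModuleCat R)
    [Module.Flat R F] (i : ℕ) : IsZero ((tcx P.complex F).homology (i + 1)) := by
  rw [← HomologicalComplex.exactAt_iff_isZero_homology]
  rw [HomologicalComplex.exactAt_iff' _ (i + 2) (i + 1) i (by simp) (by simp)]
  apply ModuleCat.shortComplex_exact
  have h := P.complex_exactAt_succ i
  rw [HomologicalComplex.exactAt_iff' _ (i + 2) (i + 1) i (by simp) (by simp)] at h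
  exact Module.Flat.lTensor_exact F ((ShortComplex.ShortExact.moduleCat_exact_iff_function_exact _).mp h)

lemma torShift {N : ModuleCat R} (S : ShortComplex (ModuleCat R)) (hS : S.ShortExact)
    [Module.Flat R S.X₂] (i : ℕ) :
    Nonempty (((Tor (ModuleCat R) (i + 2)).obj S.X₃).obj N ≅
      ((Tor (ModuleCat R) (i + 1)).obj S.X₁).obj N) := by
  let P := projectiveResolution N
  have h := tses_shortExact P.complex S hS
  have hrel : (ComplexShape.down ℕ).Rel (i + 2) (i + 1) := by simp
  exact ⟨P.isoLeftDerivedObj _ (i + 2) ≪≫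
    h.δIso (i + 2) (i + 1) hrel (tcx_homology_zero P S.X₂ (i + 1)) (tcx_homology_zero P S.X₂ i) ≪≫
    (P.isoLeftDerivedObj _ (i + 1)).symm⟩

instance (A : ModuleCat R) : PreservesFiniteColimits ((tensoringLeft (ModuleCat R)).obj A) := by
  change PreservesFiniteColimits (tensorLeft A)
  infer_instance

/-- `H_0 (A ⊗ P) = A ⊗ N` -/
noncomputable abbrev h0 {N : ModuleCat R} (P : ProjectiveResolution N) (A : ModuleCat R) :
    (tcx P.complex A).homology 0 ≅ A ⊗ N :=
  (ChainComplex.isoHomologyι₀ _) ≪≫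
    asIso (P.fromLeftDerivedZero' ((tensoringLeft (ModuleCat R)).obj A))

lemma h0_nat {N : ModuleCat R} (P : ProjectiveResolution N) {A B : ModuleCat R} (f : A ⟶ B) :
    HomologicalComplex.homologyMap (tcxMap P.complex f) 0 ≫ (h0 P B).hom =
      (h0 P A).hom ≫ f ▷ N := by
  simp only [h0, Iso.trans_hom, asIso_hom, Category.assoc]
  have : HomologicalComplex.opcyclesMap (tcxMap P.complex f) 0 ≫
      P.fromLeftDerivedZero' ((tensoringLeft (ModuleCat R)).obj B) =
      P.fromLeftDerivedZero' ((tensoringLeft (ModuleCat R)).obj A) ≫ f ▷ N := by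
    rw [← cancel_epi (HomologicalComplex.pOpcycles _ _)]
    rw [HomologicalComplex.p_opcyclesMap_assoc,
      ProjectiveResolution.pOpcycles_comp_fromLeftDerivedZero',
      ProjectiveResolution.pOpcycles_comp_fromLeftDerivedZero'_assoc]
    exact whisker_exchange f (P.π.f 0) |>.symm
  rw [← this]
  simp [ChainComplex.isoHomologyι₀]

lemma kerAux {H A B A' B' T : ModuleCat R} (d : H ⟶ A) (f : A ⟶ B) (w : d ≫ f = 0)
    (hd : Mono d) (hex : (ShortComplex.mk d f w).Exact) (t : T ≅ H) (a : A ≅ A') (b : B ≅ B')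
    (f' : A' ⟶ B') (hf : f ≫ b.hom = a.hom ≫ f') :
    Nonempty (T ≃ₗ[R] LinearMap.ker f'.hom) := by
  let φ := t.hom ≫ d ≫ a.hom
  have hφ : Mono φ := inferInstance
  have hinj : Function.Injective φ.hom := (ModuleCat.mono_iff_injective _).mp hφ
  have e2 : (ShortComplex.mk φ f' (by
      simp only [φ, Category.assoc]
      rw [← hf, reassoc_of% w]; simp)).Exact := by
    refine ShortComplex.exact_of_iso ?_ hex
    refine ShortComplex.isoMk t.symm a b ?_ ?_
    · simp [φ]
    · exact hf.symm
  rw [ShortComplex.moduleCat_exact_iff_range_eq_ker] at e2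
  exact ⟨(LinearEquiv.ofInjective φ.hom hinj).trans (LinearEquiv.ofEq _ _ e2)⟩

lemma torOne {N : ModuleCat R} (S : ShortComplex (ModuleCat R)) (hS : S.ShortExact)
    [Module.Flat R S.X₂] :
    Nonempty (((Tor (ModuleCat R) 1).obj S.X₃).obj N ≃ₗ[R]
      LinearMap.ker ((S.f ▷ N).hom)) := by
  let P := projectiveResolution N
  have h := tses_shortExact P.complex S hS
  have hrel : (ComplexShape.down ℕ).Rel 1 0 := by simp
  exact kerAux (h.δ 1 0 hrel) _ (h.δ_comp 1 0 hrel)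
    (h.mono_δ 1 0 hrel (tcx_homology_zero P S.X₂ 0)) (h.homology_exact₁ 1 0 hrel)
    (P.isoLeftDerivedObj _ 1) (h0 P S.X₁) (h0 P S.X₂) _ (h0_nat P S.f)
end TorPart

section TorMPart
variable {R : Type} [CommRing R] {K F M : Type} (N : Type) [AddCommGroup K] [Module R K]
  [AddCommGroup F] [Module R F] [AddCommGroup M] [Module R M] [AddCommGroup N] [Module R N]
  [Module.Flat R F]

lemma torM_shift (i : K →ₗ[R] F) (p : F →ₗ[R] M) (hi : Function.Injective i)
    (hp : Function.Surjective p) (hip : Function.Exact i p) (n : ℕ) :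
    Nonempty (TorM R (n + 2) M N ≃ₗ[R] TorM R (n + 1) K N) := by
  let S := ModuleCat.shortComplexOfCompEqZero i p hip.linearMap_comp_eq_zero
  have hS : S.ShortExact := ModuleCat.shortComplex_shortExact S hip hi hp
  have : Module.Flat R S.X₂ := ‹Module.Flat R F›
  obtain ⟨e⟩ := torShift (N := ModuleCat.of R N) S hS n
  exact ⟨e.toLinearEquiv⟩

lemma torM_one (i : K →ₗ[R] F) (p : F →ₗ[R] M) (hi : Function.Injective i)
    (hp : Function.Surjective p) (hip : Function.Exact i p) :
    Nonempty (TorM R 1 M N ≃ₗ[R] LinearMap.ker (i.rTensor N)) := by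
  let S := ModuleCat.shortComplexOfCompEqZero i p hip.linearMap_comp_eq_zero
  have hS : S.ShortExact := ModuleCat.shortComplex_shortExact S hip hi hp
  have : Module.Flat R S.X₂ := ‹Module.Flat R F›
  exact torOne (N := ModuleCat.of R N) S hS

lemma torM_congr {M M' : Type} [AddCommGroup M] [Module R M] [AddCommGroup M'] [Module R M']
    (e : M ≃ₗ[R] M') (n : ℕ) :
    Nonempty (TorM R n M N ≃ₗ[R] TorM R n M' N) :=
  ⟨((((Tor (ModuleCat R) n)).mapIso e.toModuleIso).app (ModuleCat.of R N)).toLinearEquiv⟩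
end TorMPart

section AlgPart
variable {R : Type} [CommRing R]

lemma mlen_eq (L : Type) [AddCommGroup L] [Module R L] :
    mlen R L = (Module.length R L).toNat := by
  unfold mlen
  split_ifs with h
  · rw [← Module.length_compositionSeries _ h.choose_spec.1 h.choose_spec.2]; simp
  · have : Module.length R L = ⊤ := by
      by_contra hc
      exact h (isFiniteLength_iff_exists_compositionSeries.mp (Module.length_ne_top_iff.mp hc))
    simp [this]

lemma length_four {A B C D : Type} [AddCommGroup A] [Module R A] [AddCommGroup B] [Module R B]
    [AddCommGroup C] [Module R C] [AddCommGroup D] [Module R D]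
    (a : A →ₗ[R] B) (b : B →ₗ[R] C) (c : C →ₗ[R] D) (hab : Function.Exact a b)
    (hbc : Function.Exact b c) :
    Module.length R A + Module.length R C =
      Module.length R B + (Module.length R (LinearMap.ker a) + Module.length R (LinearMap.range c)) := by
  have key : ∀ {A B : Type} [AddCommGroup A] [Module R A] [AddCommGroup B] [Module R B]
      (a : A →ₗ[R] B), Module.length R A =
        Module.length R (LinearMap.ker a) + Module.length R (LinearMap.range a) := by
    intro A B _ _ _ _ a
    refine Module.length_eq_add_of_exact (LinearMap.ker a).subtype a.rangeRestrict
      (Submodule.injective_subtype _) a.surjective_rangeRestrict ?_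
    rw [LinearMap.exact_iff]; simp
  rw [key a, key b, key c, LinearMap.exact_iff.mp hab, LinearMap.exact_iff.mp hbc]
  ring

section hex
variable {K F M X Y Z : Type} [AddCommGroup K] [Module R K]
  [AddCommGroup F] [Module R F] [AddCommGroup M] [Module R M]
  [AddCommGroup X] [Module R X] [AddCommGroup Y] [Module R Y] [AddCommGroup Z] [Module R Z]
  [Module.Flat R F]

lemma hexHalf (i : K →ₗ[R] F) (p : F →ₗ[R] M)
    (hp : Function.Surjective p) (hip : Function.Exact i p)
    (f : X →ₗ[R] Y) (g : Y →ₗ[R] Z) (hf : Function.Injective f) (hg : Function.Surjective g)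
    (hfg : Function.Exact f g) :
    Module.length R (LinearMap.ker (i.rTensor X)) + Module.length R (LinearMap.ker (i.rTensor Z)) =
      Module.length R (LinearMap.ker (i.rTensor Y)) +
        (Module.length R (LinearMap.ker (f.lTensor K)) +
          Module.length R (LinearMap.ker (f.lTensor M))) := by
  have cf : (f.lTensor F).comp (i.rTensor X) = (i.rTensor Y).comp (f.lTensor K) := by
    rw [LinearMap.lTensor_comp_rTensor, LinearMap.rTensor_comp_lTensor]
  have cg : (g.lTensor F).comp (i.rTensor Y) = (i.rTensor Z).comp (g.lTensor K) := by
    rw [LinearMap.lTensor_comp_rTensor, LinearMap.rTensor_comp_lTensor]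
  have fF : Function.Injective (f.lTensor F) :=
    Module.Flat.lTensor_preserves_injective_linearMap f hf
  let a : LinearMap.ker (i.rTensor X) →ₗ[R] LinearMap.ker (i.rTensor Y) :=
    (f.lTensor K).restrict (fun x hx => by
      have := LinearMap.congr_fun cf x
      simp only [LinearMap.comp_apply] at this
      rw [LinearMap.mem_ker] at hx ⊢
      rw [← this, hx, map_zero])
  let b : LinearMap.ker (i.rTensor Y) →ₗ[R] LinearMap.ker (i.rTensor Z) :=
    (g.lTensor K).restrict (fun x hx => by
      have := LinearMap.congr_fun cg x
      simp only [LinearMap.comp_apply] at this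
      rw [LinearMap.mem_ker] at hx ⊢
      rw [← this, hx, map_zero])
  have exK : Function.Exact (f.lTensor K) (g.lTensor K) := lTensor_exact K hfg hg
  have exF : Function.Exact (f.lTensor F) (g.lTensor F) := lTensor_exact F hfg hg
  have sK : Function.Surjective (g.lTensor K) := LinearMap.lTensor_surjective K hg
  let δ := SnakeLemma.δ' (i.rTensor X) (i.rTensor Y) (i.rTensor Z) (f.lTensor K) (g.lTensor K) exK
    (f.lTensor F) (g.lTensor F) exF cf cg (LinearMap.ker (i.rTensor Z)).subtype
    (LinearMap.exact_subtype_ker_map _) (p.rTensor X) (rTensor_exact X hip hp) sK fF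
  have e1 : Function.Exact b δ :=
    SnakeLemma.exact_δ'_right (i.rTensor X) (i.rTensor Y) (i.rTensor Z) (f.lTensor K)
      (g.lTensor K) exK (f.lTensor F) (g.lTensor F) exF cf cg
      (LinearMap.ker (i.rTensor Y)).subtype (LinearMap.exact_subtype_ker_map _)
      (LinearMap.ker (i.rTensor Z)).subtype
      (LinearMap.exact_subtype_ker_map _) (p.rTensor X) (rTensor_exact X hip hp) sK fF
      b rfl (Submodule.injective_subtype _)
  have e2 : Function.Exact δ (f.lTensor M) :=
    SnakeLemma.exact_δ'_left (i.rTensor X) (i.rTensor Y) (i.rTensor Z) (f.lTensor K)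
      (g.lTensor K) exK (f.lTensor F) (g.lTensor F) exF cf cg
      (LinearMap.ker (i.rTensor Z)).subtype
      (LinearMap.exact_subtype_ker_map _) (p.rTensor X) (rTensor_exact X hip hp)
      (p.rTensor Y) (rTensor_exact Y hip hp) sK fF
      (f.lTensor M) (by rw [LinearMap.lTensor_comp_rTensor, LinearMap.rTensor_comp_lTensor])
      (LinearMap.rTensor_surjective X hp)
  have hk : ∀ x, f.lTensor K x = 0 → i.rTensor X x = 0 := by
    intro x hx
    apply fF
    have := LinearMap.congr_fun cf x
    simp only [LinearMap.comp_apply] at this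
    rw [this, hx, map_zero, map_zero]
  have hab : Function.Exact a b := by
    intro y
    constructor
    · intro hy
      have : g.lTensor K y.1 = 0 := congrArg Subtype.val hy
      obtain ⟨x, hx⟩ := (exK y.1).mp this
      refine ⟨⟨x, ?_⟩, Subtype.ext hx⟩
      rw [LinearMap.mem_ker]
      apply fF
      have h := LinearMap.congr_fun cf x
      simp only [LinearMap.comp_apply] at h
      rw [h, hx, map_zero]
      exact y.2
    · rintro ⟨x, rfl⟩
      exact Subtype.ext (exK.apply_apply_eq_zero x.1)
  rw [length_four a b δ hab e1, ← LinearMap.exact_iff.mp e2]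
  congr 2
  have hle : LinearMap.ker (f.lTensor K) ≤ LinearMap.ker (i.rTensor X) := fun x hx => hk x hx
  have : LinearMap.ker a = (LinearMap.ker (f.lTensor K)).submoduleOf (LinearMap.ker (i.rTensor X)) := by
    ext x
    exact Subtype.ext_iff
  rw [this]
  exact (Submodule.submoduleOfEquivOfLe hle).length_eq
end hex

/-- elements for which multiplication on `M` factors through `g` -/
def facIdeal {F M : Type} [AddCommGroup F] [Module R F] [AddCommGroup M] [Module R M]
    (g : F →ₗ[R] M) : Ideal R where
  carrier := {r | ∃ h : M →ₗ[R] F, g ∘ₗ h = r • LinearMap.id}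
  add_mem' := by
    rintro a b ⟨h, hh⟩ ⟨h', hh'⟩
    exact ⟨h + h', by rw [LinearMap.comp_add, hh, hh', add_smul]⟩
  zero_mem' := ⟨0, by simp⟩
  smul_mem' := by
    rintro c a ⟨h, hh⟩
    exact ⟨c • h, by rw [LinearMap.comp_smul, hh, smul_eq_mul, mul_smul]⟩

section fin
variable [IsNoetherianRing R] [IsLocalRing R]

lemma length_ne_top_of_pow {L : Type} [AddCommGroup L] [Module R L] [Module.Finite R L] (k : ℕ)
    (h : ∀ r ∈ maximalIdeal R ^ k, ∀ x : L, r • x = 0) : Module.length R L ≠ ⊤ := by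
  have : IsArtinian R (R ⧸ maximalIdeal R ^ k) := by
    rcases Nat.eq_zero_or_pos k with rfl | hk
    · rw [pow_zero, Ideal.one_eq_top]
      infer_instance
    have : Nontrivial (R ⧸ maximalIdeal R ^ k) :=
      Ideal.Quotient.nontrivial_iff.mpr (fun h => 
        (maximalIdeal.isMaximal R).ne_top (top_le_iff.mp (h ▸ Ideal.pow_le_self hk.ne')))
    have : IsLocalRing (R ⧸ maximalIdeal R ^ k) :=
      .of_surjective' (Ideal.Quotient.mk _) Ideal.Quotient.mk_surjective
    have : IsArtinianRing (R ⧸ maximalIdeal R ^ k) := by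
      rw [isArtinianRing_iff_isNilpotent_maximalIdeal]
      refine ⟨k, ?_⟩
      rw [← IsLocalRing.map_maximalIdeal_of_surjective _ Ideal.Quotient.mk_surjective, ← Ideal.map_pow, Ideal.map_quotient_self]; rfl
    exact isArtinian_of_surjective_algebraMap (R := R ⧸ maximalIdeal R ^ k) (S := R)
      Ideal.Quotient.mk_surjective
  obtain ⟨n, φ, hφ⟩ := Module.Finite.exists_fin' R L
  have : IsArtinian R L := by
    let ψ : (Fin n → (R ⧸ maximalIdeal R ^ k)) →ₗ[R] L :=
      LinearMap.lsum R (fun _ => R ⧸ maximalIdeal R ^ k) R (fun j =>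
        Submodule.liftQ (maximalIdeal R ^ k) (LinearMap.toSpanSingleton R L (φ (Pi.single j 1)))
          (fun r hr => by simp [h r hr]))
    refine isArtinian_of_surjective _ ψ (fun y => ?_)
    obtain ⟨v, rfl⟩ := hφ y
    refine ⟨fun j => Ideal.Quotient.mk _ (v j), ?_⟩
    have hv : φ v = ∑ j, φ (Pi.single j (v j)) := by
      rw [← map_sum, Finset.univ_sum_single]
    rw [hv]
    simp only [ψ, LinearMap.lsum_apply, LinearMap.sum_apply, LinearMap.comp_apply, LinearMap.proj_apply]
    refine Finset.sum_congr rfl fun j _ => ?_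
    change v j • φ (Pi.single j 1) = _
    rw [← map_smul]
    congr 1
    simp [← Pi.single_smul]
  exact Module.length_ne_top

lemma exists_pow_le_facIdeal {F M : Type} [AddCommGroup F] [Module R F] [AddCommGroup M]
    [Module R M] [Module.Finite R M] (g : F →ₗ[R] M) (hg : Function.Surjective g)
    (hloc : LocFreePunctured R M) : ∃ k, maximalIdeal R ^ k ≤ facIdeal g := by
  apply Ideal.exists_pow_le_of_le_radical_of_fg _ (IsNoetherian.noetherian _)
  rw [Ideal.radical_eq_sInf]
  refine le_sInf ?_
  rintro p ⟨hp, hprime⟩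
  by_contra hne
  have hne' : p ≠ maximalIdeal R := by rintro rfl; exact hne le_rfl
  have hfree := hloc p hprime hne'
  have hFP : Module.FinitePresentation R M := Module.finitePresentation_of_finite R M
  let gp := LocalizedModule.map p.primeCompl g
  have hgp : Function.Surjective gp := LocalizedModule.map_surjective _ _ hg
  obtain ⟨σ, hσ⟩ := Module.projective_lifting_property gp LinearMap.id hgp
  let mkM := LocalizedModule.mkLinearMap p.primeCompl M
  let mkF := LocalizedModule.mkLinearMap p.primeCompl F
  obtain ⟨h, s, hs⟩ := Module.FinitePresentation.exists_lift_of_isLocalizedModule p.primeCompl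
    mkF ((σ.restrictScalars R) ∘ₗ mkM)
  have key : mkM.comp (g ∘ₗ h) = mkM.comp (s.1 • LinearMap.id) := by
    ext x
    have h1 : mkM (g (h x)) = gp (mkF (h x)) := by
      simp [gp, mkM, mkF, LocalizedModule.map_mk]
    have h2 : mkF (h x) = s.1 • σ (mkM x) := LinearMap.congr_fun hs x
    have h3 : gp (σ (mkM x)) = mkM x := LinearMap.congr_fun hσ (mkM x)
    simp only [LinearMap.comp_apply, LinearMap.smul_apply, LinearMap.id_apply, map_smul]
    rw [h1, h2, ← h3]
    rw [h3]
    conv_rhs => rw [← h3]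
    exact map_smul (gp.restrictScalars R) s.1 _
  obtain ⟨t, ht⟩ := Module.Finite.exists_smul_of_comp_eq_of_isLocalizedModule p.primeCompl mkM _ _ key
  have : t.1 * s.1 ∈ facIdeal g := by
    refine ⟨t.1 • h, ?_⟩
    rw [LinearMap.comp_smul, mul_smul]
    exact ht
  exact (t * s).2 (hp this)

end fin

section fac
variable {K F M : Type} [AddCommGroup K] [Module R K]
  [AddCommGroup F] [Module R F] [AddCommGroup M] [Module R M]

/-- if `r` factors through `p : F → M`, it factors through `i : K → F`. -/
lemma fac_left (i : K →ₗ[R] F) (p : F →ₗ[R] M) (hi : Function.Injective i)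
    (hip : Function.Exact i p) (r : R) (h : M →ₗ[R] F) (hh : p ∘ₗ h = r • LinearMap.id) :
    ∃ s : F →ₗ[R] K, s ∘ₗ i = r • LinearMap.id := by
  let e := LinearEquiv.ofInjective i hi
  let u : F →ₗ[R] F := r • LinearMap.id - h ∘ₗ p
  have hu : ∀ x, u x ∈ LinearMap.range i := by
    intro x
    rw [← LinearMap.exact_iff.mp hip, LinearMap.mem_ker]
    have := LinearMap.congr_fun hh (p x)
    simp only [LinearMap.comp_apply, LinearMap.smul_apply, LinearMap.id_apply] at this
    simp [u, this]
  refine ⟨e.symm.toLinearMap ∘ₗ u.codRestrict _ hu, ?_⟩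
  ext x
  apply hi
  have h1 : ∀ y, i (e.symm y) = y.1 := fun y => congrArg Subtype.val (e.apply_symm_apply y)
  simp [h1, u, hip.apply_apply_eq_zero]

lemma kills (i : K →ₗ[R] F) (r : R) (s : F →ₗ[R] K) (hs : s ∘ₗ i = r • LinearMap.id)
    (N : Type) [AddCommGroup N] [Module R N] (x : LinearMap.ker (i.rTensor N)) : r • x = 0 := by
  apply Subtype.ext
  have h1 : (s.rTensor N) ((i.rTensor N) x.1) = r • x.1 := by
    rw [← LinearMap.comp_apply, ← LinearMap.rTensor_comp, hs, LinearMap.rTensor_smul]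
    simp
  have h2 : i.rTensor N x.1 = 0 := x.2
  rw [h2, map_zero] at h1
  exact h1.symm
end fac
end AlgPart

/-- The final argument with the periodicity data unpacked. -/
lemma theta_aux {R : Type} [CommRing R] [IsNoetherianRing R] [IsLocalRing R]
    {M K F₀ F₁ : Type} [AddCommGroup M] [Module R M] [Module.Finite R M]
    [AddCommGroup K] [Module R K] [Module.Finite R K]
    [AddCommGroup F₀] [Module R F₀] [Module.Free R F₀]
    [AddCommGroup F₁] [Module R F₁] [Module.Free R F₁]
    (i : K →ₗ[R] F₀) (p : F₀ →ₗ[R] M) (hi : Function.Injective i) (hp : Function.Surjective p)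
    (hip : Function.Exact i p)
    (j : M →ₗ[R] F₁) (q : F₁ →ₗ[R] K) (hj : Function.Injective j) (hq : Function.Surjective q)
    (hjq : Function.Exact j q) (hloc : LocFreePunctured R M) :
    (∀ (N : Type) [AddCommGroup N] [Module R N] [Module.Finite R N],
      ∀ n m : ℕ, 1 ≤ n → 1 ≤ m → theta R M N n = theta R M N m) ∧
    (∀ (X : Type) [AddCommGroup X] [Module R X] [Module.Finite R X],
     ∀ (Y : Type) [AddCommGroup Y] [Module R Y] [Module.Finite R Y],
     ∀ (Z : Type) [AddCommGroup Z] [Module R Z] [Module.Finite R Z],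
     ∀ (f : X →ₗ[R] Y) (g : Y →ₗ[R] Z),
       Function.Injective f → Function.Surjective g →
       LinearMap.range f = LinearMap.ker g →
       theta R M Y 1 = theta R M X 1 + theta R M Z 1) := by
  have congrLen : ∀ {A B : Type} [AddCommGroup A] [Module R A] [AddCommGroup B] [Module R B],
      Nonempty (A ≃ₗ[R] B) → mlen R A = mlen R B := by
    rintro A B _ _ _ _ ⟨e⟩
    rw [mlen_eq, mlen_eq, e.length_eq]
  constructor
  · intro N _ _ _
    have step : ∀ n, mlen R (TorM R (n + 3) M N) = mlen R (TorM R (n + 1) M N) := fun n =>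
      (congrLen (torM_shift N i p hi hp hip (n + 1))).trans
        (congrLen (torM_shift N j q hj hq hjq n))
    have main : ∀ n, theta R M N (n + 1) = theta R M N 1 := by
      intro n
      induction n with
      | zero => rfl
      | succ n ih =>
        rw [← ih]
        unfold theta
        have h1 : 2 * (n + 1 + 1) = (2 * n + 1) + 3 := by ring
        have h2 : 2 * (n + 1 + 1) - 1 = 2 * n + 3 := by omega
        have h3 : 2 * (n + 1) = (2 * n + 1) + 1 := by ring
        have h4 : 2 * (n + 1) - 1 = 2 * n + 1 := by omega
        rw [h2, h4, h1, h3, step, step]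
    intro n m hn hm
    obtain ⟨n, rfl⟩ := Nat.exists_eq_add_of_le' hn
    obtain ⟨m, rfl⟩ := Nat.exists_eq_add_of_le' hm
    rw [main n, main m]
  · obtain ⟨k, hk⟩ := exists_pow_le_facIdeal p hp hloc
    have th : ∀ (N : Type) [AddCommGroup N] [Module R N], theta R M N 1 =
        ((Module.length R (LinearMap.ker (j.rTensor N))).toNat : ℤ) -
          ((Module.length R (LinearMap.ker (i.rTensor N))).toNat : ℤ) := by
      intro N _ _
      unfold theta
      rw [← mlen_eq, ← mlen_eq, ← congrLen (torM_one N i p hi hp hip),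
        ← congrLen (torM_one N j q hj hq hjq), ← congrLen (torM_shift N i p hi hp hip 0)]
    have finA : ∀ (N : Type) [AddCommGroup N] [Module R N] [Module.Finite R N],
        Module.length R (LinearMap.ker (i.rTensor N)) ≠ ⊤ := by
      intro N _ _ _
      refine length_ne_top_of_pow k fun r hr x => ?_
      obtain ⟨h, hh⟩ := hk hr
      obtain ⟨s, hs⟩ := fac_left i p hi hip r h hh
      exact kills i r s hs N x
    have finB : ∀ (N : Type) [AddCommGroup N] [Module R N] [Module.Finite R N],
        Module.length R (LinearMap.ker (j.rTensor N)) ≠ ⊤ := by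
      intro N _ _ _
      refine length_ne_top_of_pow k fun r hr x => ?_
      obtain ⟨h, hh⟩ := hk hr
      obtain ⟨s, hs⟩ := fac_left i p hi hip r h hh
      obtain ⟨s', hs'⟩ := Module.projective_lifting_property q s hq
      obtain ⟨t, ht⟩ := fac_left j q hj hjq r (s' ∘ₗ i) (by rw [← LinearMap.comp_assoc, hs', hs])
      exact kills j r t ht N x
    intro X _ _ _ Y _ _ _ Z _ _ _ f g hf hg hfg
    have hex : Function.Exact f g := LinearMap.exact_iff.mpr hfg.symm
    have hA := hexHalf i p hp hip f g hf hg hex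
    have hB := hexHalf j q hq hjq f g hf hg hex
    rw [th, th, th]
    have h1 := finA X
    have h2 := finA Y
    have h3 := finA Z
    have h4 := finB X
    have h5 := finB Y
    have h6 := finB Z
    generalize Module.length R (LinearMap.ker (i.rTensor X)) = a1 at *
    generalize Module.length R (LinearMap.ker (i.rTensor Y)) = a2 at *
    generalize Module.length R (LinearMap.ker (i.rTensor Z)) = a3 at *
    generalize Module.length R (LinearMap.ker (j.rTensor X)) = b1 at *
    generalize Module.length R (LinearMap.ker (j.rTensor Y)) = b2 at *
    generalize Module.length R (LinearMap.ker (j.rTensor Z)) = b3 at *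
    generalize Module.length R (LinearMap.ker (f.lTensor K)) = c1 at *
    generalize Module.length R (LinearMap.ker (f.lTensor M)) = c2 at *
    lift a1 to ℕ using h1
    lift a2 to ℕ using h2
    lift a3 to ℕ using h3
    lift b1 to ℕ using h4
    lift b2 to ℕ using h5
    lift b3 to ℕ using h6
    have hc1 : c1 ≠ ⊤ := by
      rintro rfl
      simp only [top_add, add_top] at hA
      exact ENat.coe_ne_top (a1 + a3) (by exact_mod_cast hA)
    have hc2 : c2 ≠ ⊤ := by
      rintro rfl
      simp only [add_top] at hA
      exact ENat.coe_ne_top (a1 + a3) (by exact_mod_cast hA)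
    lift c1 to ℕ using hc1
    lift c2 to ℕ using hc2
    norm_cast at hA hB
    simp only [ENat.toNat_coe]
    omega

theorem theta_well_defined_and_additive
    (R : Type) [CommRing R] [IsNoetherianRing R] [IsLocalRing R]
    (M : Type) [AddCommGroup M] [Module R M] [Module.Finite R M]
    (hper : IsPeriodicSyzygy R M 2) (hloc : LocFreePunctured R M) :
    (∀ (N : Type) [AddCommGroup N] [Module R N] [Module.Finite R N],
      ∀ n m : ℕ, 1 ≤ n → 1 ≤ m → theta R M N n = theta R M N m) ∧
    (∀ (X : Type) [AddCommGroup X] [Module R X] [Module.Finite R X],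
     ∀ (Y : Type) [AddCommGroup Y] [Module R Y] [Module.Finite R Y],
     ∀ (Z : Type) [AddCommGroup Z] [Module R Z] [Module.Finite R Z],
     ∀ (f : X →ₗ[R] Y) (g : Y →ₗ[R] Z),
       Function.Injective f → Function.Surjective g →
       LinearMap.range f = LinearMap.ker g →
       theta R M Y 1 = theta R M X 1 + theta R M Z 1) := by
  obtain ⟨n, d, g, hg, hk0, hk, -, -, ⟨e⟩⟩ := hper
  refine theta_aux (LinearMap.range (d 0)).subtype g (Submodule.injective_subtype _) hg ?_
    ((LinearMap.range (d 1)).subtype ∘ₗ e.toLinearMap) (d 0).rangeRestrict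
    ((Submodule.injective_subtype _).comp e.injective) (d 0).surjective_rangeRestrict ?_ hloc
  · rw [LinearMap.exact_iff, hk0, Submodule.range_subtype]
  · rw [LinearMap.exact_iff, LinearMap.ker_rangeRestrict, hk 0, LinearMap.range_comp,
      LinearEquiv.range, Submodule.map_top, Submodule.range_subtype]
end

section
/- Let R be a commutative Noetherian local ring, M a finitely generated R-module locally free on the punctured spectrum with M ≅ Ω^q M for some even integer q ≥ 2, and N a finitely generated R-module with [N] = 0 in the reduced Grothendieck group Ḡ(R)_ℚ. Then the pair (M,N) is (q−1)-Tor-rigid: if Tor_i^R(M,N) = 0 for all i = r, r+1, ..., r+q−2 for some r ≥ 1, then Tor_j^R(M,N) = 0 for all j ≥ r. -/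
open CategoryTheory IsLocalRing

namespace TorRig
open MonoidalCategory Limits

noncomputable section
variable {R : Type} [CommRing R]

/-- The complex `X ⊗ P` for the chosen projective resolution `P` of `N`. -/
def cx (N : Type) [AddCommGroup N] [Module R N] (X : ModuleCat.{0} R) :
    ChainComplex (ModuleCat.{0} R) ℕ :=
  (((tensoringLeft (ModuleCat.{0} R)).obj X).mapHomologicalComplex _).obj
    (projectiveResolution (ModuleCat.of R N)).complex

def cxMap (N : Type) [AddCommGroup N] [Module R N] {X Y : ModuleCat.{0} R} (f : X ⟶ Y) :
    cx N X ⟶ cx N Y :=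
  (NatTrans.mapHomologicalComplex ((tensoringLeft (ModuleCat.{0} R)).map f) _).app
    (projectiveResolution (ModuleCat.of R N)).complex

lemma cxMap_f_comp (N : Type) [AddCommGroup N] [Module R N] {X Y Z : ModuleCat.{0} R} (f : X ⟶ Y)
    (g : Y ⟶ Z) (j : ℕ) : (cxMap N f).f j ≫ (cxMap N g).f j =
    (f ≫ g) ▷ ((projectiveResolution (ModuleCat.of R N)).complex.X j) :=
  (comp_whiskerRight f g _).symm

def torIso (N : Type) [AddCommGroup N] [Module R N] (X : ModuleCat.{0} R) (i : ℕ) :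
    ((Tor (ModuleCat R) i).obj X).obj (ModuleCat.of R N) ≅ (cx N X).homology i :=
  (projectiveResolution (ModuleCat.of R N)).isoLeftDerivedObj _ i

lemma cx_homology_zero (N : Type) [AddCommGroup N] [Module R N] (X : ModuleCat.{0} R)
    [Module.Flat R X] (i : ℕ) : IsZero ((cx N X).homology (i + 1)) := by
  rw [← HomologicalComplex.exactAt_iff_isZero_homology]
  have h := (projectiveResolution (ModuleCat.of R N)).complex_exactAt_succ i
  rw [HomologicalComplex.exactAt_iff' _ (i + 2) (i + 1) i (by simp) (by simp)] at h ⊢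
  rw [ShortComplex.ShortExact.moduleCat_exact_iff_function_exact] at h ⊢
  exact Module.Flat.lTensor_exact X h

section ses
variable {K F L : Type} [AddCommGroup K] [Module R K] [AddCommGroup F] [Module R F]
  [AddCommGroup L] [Module R L] (f : K →ₗ[R] F) (g : F →ₗ[R] L)

def sesC (N : Type) [AddCommGroup N] [Module R N] (h : g.comp f = 0) :
    ShortComplex (ChainComplex (ModuleCat.{0} R) ℕ) :=
  ShortComplex.mk (cxMap N (ModuleCat.ofHom f)) (cxMap N (ModuleCat.ofHom g)) (by
    ext i : 1
    change (ModuleCat.ofHom f ▷ _) ≫ (ModuleCat.ofHom g ▷ _) = 0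
    rw [← comp_whiskerRight, ← ModuleCat.ofHom_comp, h]
    exact MonoidalPreadditive.zero_whiskerRight)

lemma sesC_shortExact (N : Type) [AddCommGroup N] [Module R N]
    (hf : Function.Injective f) (hg : Function.Surjective g) (hfg : Function.Exact f g) :
    (sesC f g N hfg.linearMap_comp_eq_zero).ShortExact := by
  apply HomologicalComplex.shortExact_of_degreewise_shortExact
  intro i
  have : Projective ((projectiveResolution (ModuleCat.of R N)).complex.X i) := inferInstance
  have hP : Module.Projective R ((projectiveResolution (ModuleCat.of R N)).complex.X i) :=
    (IsProjective.iff_projective _).mpr this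
  apply ModuleCat.shortComplex_shortExact
  · exact rTensor_exact _ hfg hg
  · exact Module.Flat.rTensor_preserves_injective_linearMap
      (M := ((projectiveResolution (ModuleCat.of R N)).complex.X i)) f hf
  · exact LinearMap.rTensor_surjective _ hg

lemma tor_shift (N : Type) [AddCommGroup N] [Module R N] [Module.Flat R F]
    (hf : Function.Injective f) (hg : Function.Surjective g) (hfg : Function.Exact f g) (i : ℕ) :
    Nonempty (TorM R (i + 2) L N ≃ₗ[R] TorM R (i + 1) K N) := by
  have hS := sesC_shortExact f g N hf hg hfg
  have : Module.Flat R (ModuleCat.of R F) := ‹_›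
  exact ⟨((torIso N (ModuleCat.of R L) (i+2)) ≪≫ hS.δIso (i+2) (i+1) rfl
    (cx_homology_zero N (ModuleCat.of R F) (i+1)) (cx_homology_zero N (ModuleCat.of R F) i) ≪≫
    (torIso N (ModuleCat.of R K) (i+1)).symm).toLinearEquiv⟩

/-- the map `H_0(X ⊗ P) → X ⊗ N`, on opcycles -/
def op0 (N : Type) [AddCommGroup N] [Module R N] (X : ModuleCat.{0} R) :
    (cx N X).opcycles 0 ⟶ X ⊗ ModuleCat.of R N :=
  ((projectiveResolution (ModuleCat.of R N)).fromLeftDerivedZero'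
    ((tensoringLeft (ModuleCat.{0} R)).obj X))

instance (N : Type) [AddCommGroup N] [Module R N] (X : ModuleCat.{0} R) : IsIso (op0 N X) := by
  have : PreservesFiniteColimits ((tensoringLeft (ModuleCat.{0} R)).obj X) :=
    inferInstanceAs (PreservesFiniteColimits (tensorLeft X))
  exact inferInstanceAs (IsIso ((projectiveResolution (ModuleCat.of R N)).fromLeftDerivedZero'
    ((tensoringLeft (ModuleCat.{0} R)).obj X)))

lemma p_op0 (N : Type) [AddCommGroup N] [Module R N] (X : ModuleCat.{0} R) :
    (cx N X).pOpcycles 0 ≫ op0 N X =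
      ((tensoringLeft (ModuleCat.{0} R)).obj X).map
        ((projectiveResolution (ModuleCat.of R N)).π.f 0) :=
  ProjectiveResolution.pOpcycles_comp_fromLeftDerivedZero' _ _

/-- `H_0(X ⊗ P) ≅ X ⊗ N`. -/
def h0 (N : Type) [AddCommGroup N] [Module R N] (X : ModuleCat.{0} R) :
    (cx N X).homology 0 ≅ X ⊗ ModuleCat.of R N :=
  ChainComplex.isoHomologyι₀ (cx N X) ≪≫ asIso (op0 N X)

lemma op0_nat (N : Type) [AddCommGroup N] [Module R N] {X Y : ModuleCat.{0} R} (φ : X ⟶ Y) :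
    HomologicalComplex.opcyclesMap (cxMap N φ) 0 ≫ op0 N Y =
      op0 N X ≫ (φ ▷ ModuleCat.of R N) := by
  have e : Epi ((cx N X).pOpcycles 0) := inferInstance
  apply e.left_cancellation
  rw [HomologicalComplex.p_opcyclesMap_assoc, p_op0, ← Category.assoc, p_op0]
  exact (((tensoringLeft (ModuleCat.{0} R)).map φ).naturality _).symm

lemma h0_nat (N : Type) [AddCommGroup N] [Module R N] {X Y : ModuleCat.{0} R} (φ : X ⟶ Y) :
    HomologicalComplex.homologyMap (cxMap N φ) 0 ≫ (h0 N Y).hom =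
      (h0 N X).hom ≫ (φ ▷ ModuleCat.of R N) := by
  have key := op0_nat N φ
  have hn := HomologicalComplex.homologyι_naturality (cxMap N φ) 0
  calc _ = HomologicalComplex.homologyMap (cxMap N φ) 0 ≫ (cx N Y).homologyι 0 ≫ op0 N Y := rfl
    _ = (cx N X).homologyι 0 ≫ (HomologicalComplex.opcyclesMap (cxMap N φ) 0 ≫ op0 N Y) := by
        rw [reassoc_of% hn]
    _ = _ := by rw [key]; rfl

/-- kernels of conjugate maps agree -/
lemma kerEquiv {A B A' B' : Type} [AddCommGroup A] [Module R A] [AddCommGroup B] [Module R B]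
    [AddCommGroup A'] [Module R A'] [AddCommGroup B'] [Module R B']
    (u : A →ₗ[R] B) (v : A' →ₗ[R] B') (eA : A ≃ₗ[R] A') (eB : B ≃ₗ[R] B')
    (h : ∀ x, eB (u x) = v (eA x)) {T : Type} [AddCommGroup T] [Module R T] (d : T →ₗ[R] A)
    (hd : Function.Injective d) (hex : LinearMap.range d = LinearMap.ker u) :
    Nonempty (T ≃ₗ[R] LinearMap.ker v) := by
  have hmap : (LinearMap.range d).map (eA : A →ₗ[R] A') = LinearMap.ker v := by
    rw [hex]
    ext x
    obtain ⟨y, rfl⟩ := eA.surjective x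
    rw [LinearMap.mem_ker, ← h, LinearEquiv.map_eq_zero_iff]
    constructor
    · rintro ⟨z, hz, hzy⟩
      obtain rfl := eA.injective hzy
      exact hz
    · intro h
      exact ⟨y, h, rfl⟩
  exact ⟨LinearEquiv.ofInjective _ hd ≪≫ₗ eA.submoduleMap _ ≪≫ₗ LinearEquiv.ofEq _ _ hmap⟩

lemma tor_one (N : Type) [AddCommGroup N] [Module R N] [Module.Flat R F]
    (hf : Function.Injective f) (hg : Function.Surjective g) (hfg : Function.Exact f g) :
    Nonempty (TorM R 1 L N ≃ₗ[R] LinearMap.ker (f.rTensor N)) := by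
  have hS := sesC_shortExact f g N hf hg hfg
  have : Module.Flat R (ModuleCat.of R F) := ‹_›
  have hm : Mono (hS.δ 1 0 rfl) := hS.mono_δ _ _ _ (cx_homology_zero N (ModuleCat.of R F) 0)
  have hex := hS.homology_exact₁ 1 0 rfl
  rw [ShortComplex.moduleCat_exact_iff_range_eq_ker] at hex
  have hinj : Function.Injective (hS.δ 1 0 rfl).hom := (ModuleCat.mono_iff_injective _).1 hm
  have hn := h0_nat N (ModuleCat.ofHom f)
  obtain ⟨e⟩ := kerEquiv (HomologicalComplex.homologyMap (cxMap N (ModuleCat.ofHom f)) 0).hom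
    (f.rTensor N) (h0 N (ModuleCat.of R K)).toLinearEquiv (h0 N (ModuleCat.of R F)).toLinearEquiv
    (fun x => congrArg (fun t => t.hom x) hn) (hS.δ 1 0 rfl).hom hinj hex
  exact ⟨(torIso N (ModuleCat.of R L) 1).toLinearEquiv ≪≫ₗ e⟩
end ses

lemma smul_whisk (a : R) (M : Type) [AddCommGroup M] [Module R M] (P : ModuleCat.{0} R) :
    ModuleCat.ofHom (a • (LinearMap.id : M →ₗ[R] M)) ▷ P = a • 𝟙 (ModuleCat.of R M ⊗ P) := by
  rw [← id_whiskerRight, ← MonoidalLinear.smul_whiskerRight]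
  rfl

lemma homologyMap_smul_id (a : R) (C : ChainComplex (ModuleCat.{0} R) ℕ) (i : ℕ) :
    HomologicalComplex.homologyMap (a • 𝟙 C) i = a • 𝟙 (C.homology i) := by
  have h : (HomologicalComplex.shortComplexFunctor (ModuleCat.{0} R) (ComplexShape.down ℕ) i).map
    (a • 𝟙 C) = a • 𝟙 (C.sc i) := by
    ext <;> rfl
  unfold HomologicalComplex.homologyMap
  rw [h, ShortComplex.homologyMap_smul, ShortComplex.homologyMap_id]
  rfl

lemma tor_smul (N : Type) [AddCommGroup N] [Module R N] {M F : Type} [AddCommGroup M] [Module R M]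
    [AddCommGroup F] [Module R F] [Module.Flat R F] (g : F →ₗ[R] M) (s : M →ₗ[R] F) (a : R)
    (h : g.comp s = a • LinearMap.id) (i : ℕ) (x : TorM R (i + 1) M N) : a • x = 0 := by
  have : Module.Flat R (ModuleCat.of R F) := ‹_›
  have hz := cx_homology_zero N (ModuleCat.of R F) i
  have h1 : cxMap N (ModuleCat.ofHom s) ≫ cxMap N (ModuleCat.ofHom g) =
      a • 𝟙 (cx N (ModuleCat.of R M)) := by
    ext j : 1
    rw [HomologicalComplex.comp_f, HomologicalComplex.smul_f_apply, HomologicalComplex.id_f]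
    refine (cxMap_f_comp N (ModuleCat.ofHom s) (ModuleCat.ofHom g) j).trans ?_
    rw [← ModuleCat.ofHom_comp, h]
    exact smul_whisk a _ _
  have h2 : HomologicalComplex.homologyMap (a • 𝟙 (cx N (ModuleCat.of R M))) (i+1) =
      a • 𝟙 _ := by
    exact homologyMap_smul_id a _ _
  rw [← h1, HomologicalComplex.homologyMap_comp, hz.eq_of_tgt (HomologicalComplex.homologyMap _ _) 0,
    Limits.zero_comp] at h2
  let e := (torIso N (ModuleCat.of R M) (i+1)).toLinearEquiv
  apply e.injective
  rw [map_smul, map_zero]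
  exact congrArg (fun t => t.hom (e x)) h2.symm

end
end TorRig

namespace TorRig

lemma length_ker_range {R : Type*} [CommRing R] {A B : Type*} [AddCommGroup A] [Module R A]
    [AddCommGroup B] [Module R B] (φ : A →ₗ[R] B) :
    Module.length R A = Module.length R (LinearMap.ker φ) + Module.length R (LinearMap.range φ) :=
  Module.length_eq_add_of_exact (LinearMap.ker φ).subtype φ.rangeRestrict
    (Submodule.subtype_injective _) φ.surjective_rangeRestrict (by
      rw [LinearMap.exact_iff, LinearMap.ker_rangeRestrict, Submodule.range_subtype])

section snake
variable {R : Type*} [CommRing R] {M₁ M₂ M₃ N₁ N₂ N₃ C₁ C₂ : Type*}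
  [AddCommGroup M₁] [Module R M₁] [AddCommGroup M₂] [Module R M₂] [AddCommGroup M₃] [Module R M₃]
  [AddCommGroup N₁] [Module R N₁] [AddCommGroup N₂] [Module R N₂] [AddCommGroup N₃] [Module R N₃]
  [AddCommGroup C₁] [Module R C₁] [AddCommGroup C₂] [Module R C₂]

lemma snake_length
    (i₁ : M₁ →ₗ[R] N₁) (i₂ : M₂ →ₗ[R] N₂) (i₃ : M₃ →ₗ[R] N₃)
    (f₁ : M₁ →ₗ[R] M₂) (f₂ : M₂ →ₗ[R] M₃) (hf : Function.Exact f₁ f₂)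
    (g₁ : N₁ →ₗ[R] N₂) (g₂ : N₂ →ₗ[R] N₃) (hg : Function.Exact g₁ g₂)
    (h₁ : g₁.comp i₁ = i₂.comp f₁) (h₂ : g₂.comp i₂ = i₃.comp f₂)
    (π₁ : N₁ →ₗ[R] C₁) (hπ₁ : Function.Exact i₁ π₁) (π₂ : N₂ →ₗ[R] C₂) (hπ₂ : Function.Exact i₂ π₂)
    (hf₂ : Function.Surjective f₂) (hg₁ : Function.Injective g₁)
    (G : C₁ →ₗ[R] C₂) (hG : G.comp π₁ = π₂.comp g₁) (hs : Function.Surjective π₁) :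
    Module.length R (LinearMap.ker i₁) + Module.length R (LinearMap.ker i₃) =
      Module.length R (LinearMap.ker i₂) + Module.length R (LinearMap.ker f₁) +
        Module.length R (LinearMap.ker G) ∧
    Module.length R (LinearMap.ker f₁) ≤ Module.length R (LinearMap.ker i₁) := by
  have h₁' : ∀ x, g₁ (i₁ x) = i₂ (f₁ x) := fun x => LinearMap.congr_fun h₁ x
  have h₂' : ∀ x, g₂ (i₂ x) = i₃ (f₂ x) := fun x => LinearMap.congr_fun h₂ x
  let a : LinearMap.ker i₁ →ₗ[R] LinearMap.ker i₂ := f₁.restrict (fun x hx => by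
    rw [LinearMap.mem_ker] at hx ⊢
    rw [← h₁', hx, map_zero])
  let b : LinearMap.ker i₂ →ₗ[R] LinearMap.ker i₃ := f₂.restrict (fun x hx => by
    rw [LinearMap.mem_ker] at hx ⊢
    rw [← h₂', hx, map_zero])
  let δ := SnakeLemma.δ' i₁ i₂ i₃ f₁ f₂ hf g₁ g₂ hg h₁ h₂ (LinearMap.ker i₃).subtype
    (LinearMap.exact_subtype_ker_map i₃) π₁ hπ₁ hf₂ hg₁
  have e1 : Function.Exact b δ := SnakeLemma.exact_δ'_right i₁ i₂ i₃ f₁ f₂ hf g₁ g₂ hg h₁ h₂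
    (LinearMap.ker i₂).subtype (LinearMap.exact_subtype_ker_map i₂) (LinearMap.ker i₃).subtype
    (LinearMap.exact_subtype_ker_map i₃) π₁ hπ₁ hf₂ hg₁ b (by ext; rfl)
    (Submodule.subtype_injective _)
  have e2 : Function.Exact δ G := SnakeLemma.exact_δ'_left i₁ i₂ i₃ f₁ f₂ hf g₁ g₂ hg h₁ h₂
    (LinearMap.ker i₃).subtype
    (LinearMap.exact_subtype_ker_map i₃) π₁ hπ₁ π₂ hπ₂ hf₂ hg₁ G hG hs
  have e0 : LinearMap.ker b = LinearMap.range a := by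
    ext ⟨x, hx⟩
    constructor
    · intro h
      have h' : f₂ x = 0 := congrArg Subtype.val (LinearMap.mem_ker.1 h)
      obtain ⟨y, rfl⟩ := (hf x).1 h'
      have hy : i₁ y = 0 := by
        apply hg₁
        rw [map_zero, h₁']
        exact hx
      exact ⟨⟨y, hy⟩, rfl⟩
    · rintro ⟨y, hy⟩
      have : f₁ y = x := congrArg Subtype.val hy
      apply Subtype.ext
      exact (hf x).2 ⟨y, this⟩
  have hle : LinearMap.ker f₁ ≤ LinearMap.ker i₁ := by
    intro x hx
    rw [LinearMap.mem_ker] at hx ⊢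
    apply hg₁
    rw [map_zero, h₁', hx, map_zero]
  have hinj := Submodule.inclusion_injective hle
  have ea : LinearMap.ker a = LinearMap.range (Submodule.inclusion hle) := by
    ext ⟨x, hx⟩
    constructor
    · intro h
      exact ⟨⟨x, congrArg Subtype.val (LinearMap.mem_ker.1 h)⟩, rfl⟩
    · rintro ⟨y, hy⟩
      obtain rfl : (y : M₁) = x := congrArg Subtype.val hy
      apply Subtype.ext
      exact y.2
  refine ⟨?_, Module.length_le_of_injective _ hinj⟩
  rw [length_ker_range a, length_ker_range b, length_ker_range δ, e0, e1.linearMap_ker_eq,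
    e2.linearMap_ker_eq, ea, ← (LinearEquiv.ofInjective _ hinj).length_eq]
  abel
end snake

lemma tensor_length {R : Type*} [CommRing R] {K F L X Y Z : Type*}
    [AddCommGroup K] [Module R K] [AddCommGroup F] [Module R F] [AddCommGroup L] [Module R L]
    [AddCommGroup X] [Module R X] [AddCommGroup Y] [Module R Y] [AddCommGroup Z] [Module R Z]
    [Module.Flat R F] (i : K →ₗ[R] F) (p : F →ₗ[R] L) (hip : Function.Exact i p)
    (hp : Function.Surjective p) (u : X →ₗ[R] Y) (v : Y →ₗ[R] Z) (hu : Function.Injective u)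
    (hv : Function.Surjective v) (huv : Function.Exact u v) :
    Module.length R (LinearMap.ker (i.rTensor X)) + Module.length R (LinearMap.ker (i.rTensor Z)) =
      Module.length R (LinearMap.ker (i.rTensor Y)) + Module.length R (LinearMap.ker (u.lTensor K)) +
        Module.length R (LinearMap.ker (u.lTensor L)) ∧
    Module.length R (LinearMap.ker (u.lTensor K)) ≤ Module.length R (LinearMap.ker (i.rTensor X)) :=
  snake_length (i.rTensor X) (i.rTensor Y) (i.rTensor Z) (u.lTensor K) (v.lTensor K)
    (lTensor_exact K huv hv) (u.lTensor F) (v.lTensor F) (lTensor_exact F huv hv)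
    (by rw [LinearMap.lTensor_comp_rTensor, LinearMap.rTensor_comp_lTensor])
    (by rw [LinearMap.lTensor_comp_rTensor, LinearMap.rTensor_comp_lTensor])
    (p.rTensor X) (rTensor_exact X hip hp) (p.rTensor Y) (rTensor_exact Y hip hp)
    (LinearMap.lTensor_surjective K hv) (Module.Flat.lTensor_preserves_injective_linearMap u hu)
    (u.lTensor L) (by rw [LinearMap.lTensor_comp_rTensor, LinearMap.rTensor_comp_lTensor])
    (LinearMap.rTensor_surjective X hp)

lemma finite_length_of_pow {R : Type*} [CommRing R] [IsNoetherianRing R] [IsLocalRing R]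
    (T : Type*) [AddCommGroup T] [Module R T] [Module.Finite R T]
    (k : ℕ) (h : ∀ a ∈ maximalIdeal R ^ k, ∀ x : T, a • x = 0) : Module.length R T ≠ ⊤ := by
  have : IsArtinian R T := by
    have hT : Module.IsTorsionBySet R T ((maximalIdeal R ^ k : Ideal R) : Set R) :=
      fun x a => h a.1 a.2 x
    rcases subsingleton_or_nontrivial (R ⧸ (maximalIdeal R ^ k)) with hs | hn
    · have : (maximalIdeal R ^ k) = ⊤ := Ideal.Quotient.subsingleton_iff.1 hs
      have hT0 : Subsingleton T := ⟨fun x y => by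
        have h1 : ∀ z : T, z = 0 := fun z => by
          simpa using h 1 (this ▸ trivial) z
        rw [h1 x, h1 y]⟩
      infer_instance
    let _ := hT.module
    have : IsScalarTower R (R ⧸ (maximalIdeal R ^ k)) T := hT.isScalarTower
    have : Module.Finite (R ⧸ (maximalIdeal R ^ k)) T := Module.Finite.of_restrictScalars_finite R _ T
    have hloc : IsLocalRing (R ⧸ (maximalIdeal R ^ k)) :=
      IsLocalRing.of_surjective' (Ideal.Quotient.mk _) Ideal.Quotient.mk_surjective
    have : IsArtinianRing (R ⧸ (maximalIdeal R ^ k)) := by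
      rw [isArtinianRing_iff_isNilpotent_maximalIdeal]
      refine ⟨k, ?_⟩
      rw [← IsLocalRing.map_maximalIdeal_of_surjective (Ideal.Quotient.mk (maximalIdeal R ^ k)) Ideal.Quotient.mk_surjective, ← Ideal.map_pow,
        Ideal.map_quotient_self, Ideal.zero_eq_bot]
    have : IsArtinian (R ⧸ (maximalIdeal R ^ k)) T := inferInstance
    exact isArtinian_of_surjective_algebraMap (Ideal.Quotient.mk_surjective (I := maximalIdeal R ^ k))
  exact Module.length_ne_top

/-- elements `a` such that `a • id` factors through `g`. -/
def facIdeal {R : Type*} [CommRing R] {F M : Type*} [AddCommGroup F] [Module R F]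
    [AddCommGroup M] [Module R M] (g : F →ₗ[R] M) : Ideal R where
  carrier := {a | ∃ s : M →ₗ[R] F, g.comp s = a • LinearMap.id}
  add_mem' := by
    rintro a b ⟨s, hs⟩ ⟨t, ht⟩
    exact ⟨s + t, by rw [LinearMap.comp_add, hs, ht, add_smul]⟩
  zero_mem' := ⟨0, by simp⟩
  smul_mem' := by
    rintro c a ⟨s, hs⟩
    exact ⟨c • s, by rw [LinearMap.comp_smul, hs, smul_smul, smul_eq_mul]⟩

lemma facIdeal_not_le {R : Type*} [CommRing R] {F M : Type*} [AddCommGroup F] [Module R F]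
    [AddCommGroup M] [Module R M] [Module.FinitePresentation R M]
    (g : F →ₗ[R] M) (hg : Function.Surjective g)
    (p : Ideal R) [p.IsPrime]
    (hfree : Module.Free (Localization.AtPrime p) (LocalizedModule p.primeCompl M)) :
    ∃ a ∈ facIdeal g, a ∉ p := by
  let S := p.primeCompl
  let gp := LocalizedModule.map S g
  have hgp : Function.Surjective gp := LocalizedModule.map_surjective S g hg
  obtain ⟨σ, hσ⟩ := Module.projective_lifting_property gp LinearMap.id hgp
  have hM : Module.Finite R M := inferInstance
  obtain ⟨s, u, hs⟩ := Module.FinitePresentation.exists_lift_of_isLocalizedModule S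
    (LocalizedModule.mkLinearMap S F) ((σ.restrictScalars R).comp (LocalizedModule.mkLinearMap S M))
  have key : (LocalizedModule.mkLinearMap S M).comp (g.comp s) =
      (LocalizedModule.mkLinearMap S M).comp ((u : R) • LinearMap.id) := by
    ext x
    have h1 := LinearMap.congr_fun hs x
    have h2 : gp (LocalizedModule.mkLinearMap S F (s x)) =
        gp ((u : R) • σ (LocalizedModule.mkLinearMap S M x)) := congrArg gp h1
    have h3 : gp (LocalizedModule.mkLinearMap S F (s x)) =
       LocalizedModule.mkLinearMap S M (g (s x)) := by
      simp [gp]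
    have h4 := LinearMap.congr_fun hσ (LocalizedModule.mkLinearMap S M x)
    have h5 : gp ((u : R) • σ (LocalizedModule.mkLinearMap S M x)) =
        (u : R) • gp (σ (LocalizedModule.mkLinearMap S M x)) :=
      (gp.restrictScalars R).map_smul _ _
    simp only [LinearMap.comp_apply, LinearMap.id_apply] at h4
    rw [h3, h5, h4] at h2
    simpa using h2
  obtain ⟨w, hw⟩ := Module.Finite.exists_smul_of_comp_eq_of_isLocalizedModule S
    (LocalizedModule.mkLinearMap S M) _ _ key
  refine ⟨(w : R) * u, ⟨(w : R) • s, ?_⟩, (w * u).2⟩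
  rw [LinearMap.comp_smul, mul_smul]
  exact hw

lemma exists_pow_le_facIdeal {R : Type*} [CommRing R] [IsNoetherianRing R] [IsLocalRing R]
    {F M : Type*} [AddCommGroup F] [Module R F] [AddCommGroup M] [Module R M] [Module.Finite R M]
    (g : F →ₗ[R] M) (hg : Function.Surjective g)
    (hloc : ∀ (p : Ideal R) (_ : p.IsPrime), p ≠ maximalIdeal R →
      Module.Free (Localization.AtPrime p) (LocalizedModule p.primeCompl M)) :
    ∃ k, maximalIdeal R ^ k ≤ facIdeal g := by
  have : Module.FinitePresentation R M := Module.finitePresentation_of_finite R M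
  apply Ideal.exists_pow_le_of_le_radical_of_fg _ (IsNoetherian.noetherian _)
  rw [Ideal.radical_eq_sInf]
  apply le_sInf
  rintro p ⟨hp, hpp⟩
  by_contra hne
  obtain ⟨a, ha, hap⟩ := facIdeal_not_le g hg p (hloc p hpp (fun h => hne h.ge))
  exact hap (hp ha)

lemma alt_sum_telescope (A : ℕ → ℤ) (n m : ℕ) :
    ∑ i ∈ Finset.range n, (-1 : ℤ) ^ i * (A (m + i) + A (m + i + 1)) =
      A m - (-1) ^ n * A (m + n) := by
  induction n with
  | zero => simp
  | succ n ih => rw [Finset.sum_range_succ, ih, pow_succ, ← add_assoc]; ring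

/-- The alternating sum over a full period is additive. -/
lemma alt_sum_zero (q : ℕ) (hqe : Even q) (A E : ℕ → ℤ) (B : ℤ)
    (hE : ∀ i, E i = A i + A (i + 1)) (hper : ∀ i, E (i + q) = E i)
    (hA0 : ∀ i, 0 ≤ A i) (hB : ∀ k, A (k * q) ≤ B) :
    ∑ i ∈ Finset.range q, (-1 : ℤ) ^ i * E i = 0 := by
  set D := ∑ i ∈ Finset.range q, (-1 : ℤ) ^ i * E i with hD
  have hperk : ∀ k i, E (k * q + i) = E i := by
    intro k
    induction k with
    | zero => simp
    | succ k ih => intro i; rw [← ih i, ← hper (k * q + i)]; congr 1; ring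
  have hstep : ∀ k, A (k * q) - A ((k + 1) * q) = D := by
    intro k
    have h := alt_sum_telescope A q (k * q)
    rw [hqe.neg_one_pow, one_mul] at h
    rw [show (k + 1) * q = k * q + q by ring, ← h, hD]
    refine Finset.sum_congr rfl fun i _ => ?_
    rw [← hE, hperk]
  have hk : ∀ k : ℕ, A 0 - A (k * q) = k * D := by
    intro k
    induction k with
    | zero => simp
    | succ k ih => push_cast; linear_combination ih + hstep k
  have hA00 := hA0 0
  by_contra hne
  have hB0 : 0 ≤ B := (hA0 _).trans (hB 0)
  have h1 := hk (B.toNat + (A 0).toNat + 1)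
  have h2 := hB (B.toNat + (A 0).toNat + 1)
  have h3 := hA0 ((B.toNat + (A 0).toNat + 1) * q)
  push_cast at h1
  rw [Int.toNat_of_nonneg hB0, Int.toNat_of_nonneg hA00] at h1
  rcases lt_or_gt_of_ne hne with h | h
  · nlinarith
  · nlinarith
end TorRig

namespace TorRig
noncomputable section

/-- A free resolution by finite free modules, with its syzygies. -/
structure Res (R : Type) [CommRing R] where
  K : ℕ → ModuleCat.{0} R
  n : ℕ → ℕ
  ι : ∀ i, K (i + 1) →ₗ[R] (Fin (n i) → R)
  π : ∀ i, (Fin (n i) → R) →ₗ[R] K i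
  inj : ∀ i, Function.Injective (ι i)
  surj : ∀ i, Function.Surjective (π i)
  ex : ∀ i, Function.Exact (ι i) (π i)

lemma exists_res {R : Type} [CommRing R] [IsLocalRing R] {M : Type} [AddCommGroup M] [Module R M]
    {q : ℕ} (hq : 1 ≤ q) (h : IsPeriodicSyzygy R M q) :
    ∃ P : Res R, Nonempty (M ≃ₗ[R] P.K 0) ∧ Nonempty (M ≃ₗ[R] P.K q) := by
  obtain ⟨n, d, g, hg, hg0, hd, -, -, he⟩ := h
  let K : ℕ → ModuleCat.{0} R := fun i => match i with
    | 0 => ModuleCat.of R M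
    | i + 1 => ModuleCat.of R (LinearMap.range (d i))
  let ι : ∀ i, K (i + 1) →ₗ[R] (Fin (n i) → R) := fun i => (LinearMap.range (d i)).subtype
  let π : ∀ i, (Fin (n i) → R) →ₗ[R] K i := fun i => match i with
    | 0 => g
    | i + 1 => (d i).rangeRestrict
  refine ⟨⟨K, n, ι, π, fun i => Submodule.subtype_injective _, ?_, ?_⟩, ⟨LinearEquiv.refl R M⟩, ?_⟩
  · rintro (_ | i)
    · exact hg
    · exact (d i).surjective_rangeRestrict
  · rintro (_ | i)
    · refine LinearMap.exact_iff.2 ?_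
      exact hg0.trans (Submodule.range_subtype _).symm
    · refine LinearMap.exact_iff.2 ?_
      exact ((LinearMap.ker_rangeRestrict _).trans (hd i)).trans (Submodule.range_subtype _).symm
  · obtain ⟨m, rfl⟩ : ∃ m, q = m + 1 := ⟨q - 1, by omega⟩
    exact he

variable {R : Type} [CommRing R]

lemma tor_congr {M M' : Type} [AddCommGroup M] [Module R M] [AddCommGroup M'] [Module R M']
    {N N' : Type} [AddCommGroup N] [Module R N] [AddCommGroup N'] [Module R N']
    (e : M ≃ₗ[R] M') (f : N ≃ₗ[R] N') (i : ℕ) : Nonempty (TorM R i M N ≃ₗ[R] TorM R i M' N') :=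
  ⟨((((Tor (ModuleCat R) i).mapIso e.toModuleIso).app (ModuleCat.of R N)).trans
    (((Tor (ModuleCat R) i).obj (ModuleCat.of R M')).mapIso f.toModuleIso)).toLinearEquiv⟩

namespace Res
variable (P : Res R) (N : Type) [AddCommGroup N] [Module R N]

lemma tor_ker (i : ℕ) : ∀ j k, k = j + i →
    Nonempty (TorM R (i + 1) (P.K j) N ≃ₗ[R] LinearMap.ker ((P.ι k).rTensor N)) := by
  induction i with
  | zero =>
    intro j k hk
    obtain rfl : j = k := hk.symm
    exact tor_one (P.ι j) (P.π j) N (P.inj j) (P.surj j) (P.ex j)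
  | succ i ih =>
    intro j k hk
    obtain ⟨e⟩ := tor_shift (P.ι j) (P.π j) N (P.inj j) (P.surj j) (P.ex j) i
    obtain ⟨e'⟩ := ih (j + 1) k (by omega)
    exact ⟨e.trans e'⟩

/-- Length of the kernel, i.e. of `Tor_{i+1}`. -/
def len (i : ℕ) : ℕ∞ := Module.length R (LinearMap.ker ((P.ι i).rTensor N))

lemma len_eq {M : Type} [AddCommGroup M] [Module R M] (e : M ≃ₗ[R] P.K 0) (i : ℕ) :
    P.len N i = Module.length R (TorM R (i + 1) M N) := by
  obtain ⟨a⟩ := tor_congr e (LinearEquiv.refl R N) (i + 1)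
  obtain ⟨b⟩ := P.tor_ker N i 0 i (by omega)
  exact (a.trans b).length_eq.symm

lemma len_congr {N' : Type} [AddCommGroup N'] [Module R N'] (f : N ≃ₗ[R] N') (i : ℕ) :
    P.len N i = P.len N' i := by
  obtain ⟨a⟩ := tor_congr (LinearEquiv.refl R (P.K 0)) f (i + 1)
  rw [P.len_eq N (LinearEquiv.refl R (P.K 0)), P.len_eq N' (LinearEquiv.refl R (P.K 0))]
  exact a.length_eq

lemma len_periodic {M : Type} [AddCommGroup M] [Module R M] (e : M ≃ₗ[R] P.K 0) (q : ℕ)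
    (e' : M ≃ₗ[R] P.K q) (i : ℕ) : P.len N (i + q) = P.len N i := by
  obtain ⟨a⟩ := tor_congr e' (LinearEquiv.refl R N) (i + 1)
  obtain ⟨b⟩ := P.tor_ker N i q (i + q) (by omega)
  rw [P.len_eq N e i]
  exact (a.trans b).length_eq.symm

lemma finite_K [IsNoetherianRing R] (i : ℕ) : Module.Finite R (P.K i) :=
  Module.Finite.of_surjective (P.π i) (P.surj i)

lemma len_ne_top [IsNoetherianRing R] [IsLocalRing R] {M : Type} [AddCommGroup M] [Module R M]
    [Module.Finite R M] (e : M ≃ₗ[R] P.K 0) (hloc : LocFreePunctured R M) [Module.Finite R N]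
    (i : ℕ) : P.len N i ≠ ⊤ := by
  have hs : Function.Surjective (e.symm.toLinearMap.comp (P.π 0)) :=
    e.symm.surjective.comp (P.surj 0)
  obtain ⟨k, hk⟩ := exists_pow_le_facIdeal (e.symm.toLinearMap.comp (P.π 0)) hs hloc
  rw [P.len_eq N e]
  obtain ⟨a⟩ := tor_congr e (LinearEquiv.refl R N) (i + 1)
  obtain ⟨b⟩ := P.tor_ker N i 0 i (by omega)
  have := P.finite_K (i + 1)
  have : Module.Finite R (LinearMap.ker ((P.ι i).rTensor N)) := inferInstance
  have : Module.Finite R (TorM R (i + 1) M N) := Module.Finite.equiv (a.trans b).symm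
  refine finite_length_of_pow _ k fun c hc x => ?_
  obtain ⟨s, hs⟩ := hk hc
  exact tor_smul N _ s c hs i x

lemma len_flat [Module.Flat R N] (i : ℕ) : P.len N i = 0 := by
  have h := Module.Flat.rTensor_preserves_injective_linearMap (M := N) (P.ι i) (P.inj i)
  rw [len, LinearMap.ker_eq_bot.2 h, Module.length_eq_zero_iff]
  infer_instance

/-- The alternating sum of lengths over one period starting at `s`. -/
def D (s q : ℕ) : ℤ := ∑ i ∈ Finset.range q, (-1 : ℤ) ^ i * ((P.len N (s + i)).toNat : ℤ)

lemma D_additive {X Y Z : Type} [AddCommGroup X] [Module R X] [AddCommGroup Y] [Module R Y]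
    [AddCommGroup Z] [Module R Z] (u : X →ₗ[R] Y) (v : Y →ₗ[R] Z) (hu : Function.Injective u)
    (hv : Function.Surjective v) (huv : Function.Exact u v) (s q : ℕ) (hqe : Even q)
    (hX : ∀ i, P.len X i ≠ ⊤) (hY : ∀ i, P.len Y i ≠ ⊤) (hZ : ∀ i, P.len Z i ≠ ⊤)
    (pX : ∀ i, P.len X (i + q) = P.len X i) (pY : ∀ i, P.len Y (i + q) = P.len Y i)
    (pZ : ∀ i, P.len Z (i + q) = P.len Z i) :
    P.D Y (s + 1) q = P.D X (s + 1) q + P.D Z (s + 1) q := by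
  let a : ℕ → ℕ∞ := fun i => Module.length R (LinearMap.ker (u.lTensor (P.K i)))
  have key : ∀ i, P.len X i + P.len Z i = P.len Y i + a (i + 1) + a i ∧ a (i + 1) ≤ P.len X i :=
    fun i => tensor_length (P.ι i) (P.π i) (P.ex i) (P.surj i) u v hu hv huv
  have ha : ∀ i, a (i + 1) ≠ ⊤ := fun i => ne_top_of_le_ne_top (hX i) (key i).2
  have key1 : ∀ i, ((P.len X (i + 1)).toNat : ℤ) + (P.len Z (i + 1)).toNat =
      (P.len Y (i + 1)).toNat + (a (i + 2)).toNat + (a (i + 1)).toNat := by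
    intro i
    have h := (key (i + 1)).1
    have h' := congrArg ENat.toNat h
    have hne : P.len Y (i + 1) + a (i + 1 + 1) ≠ ⊤ := WithTop.add_ne_top.2 ⟨hY _, ha _⟩
    rw [ENat.toNat_add (hX _) (hZ _), ENat.toNat_add hne (ha _),
      ENat.toNat_add (hY _) (ha _)] at h'
    exact_mod_cast h'
  have perk : ∀ k, P.len X (s + k * q) = P.len X s := by
    intro k
    induction k with
    | zero => simp
    | succ k ih => rw [← ih, ← pX (s + k * q)]; congr 1; ring
  have h := alt_sum_zero q hqe (fun i => ((a (s + i + 1)).toNat : ℤ))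
    (fun i => ((P.len X (s + 1 + i)).toNat : ℤ) + (P.len Z (s + 1 + i)).toNat -
      (P.len Y (s + 1 + i)).toNat) ((P.len X s).toNat : ℤ)
    (fun i => by
      have := key1 (s + i)
      rw [show s + 1 + i = s + i + 1 by ring, show s + (i + 1) + 1 = s + i + 2 by ring]
      linarith)
    (fun i => by
      simp only [← add_assoc, pX, pY, pZ])
    (fun i => by positivity)
    (fun k => by
      have := ENat.toNat_le_toNat (key (s + k * q)).2 (hX _)
      rw [perk] at this
      exact_mod_cast this)
  have h2 : P.D X (s + 1) q + P.D Z (s + 1) q - P.D Y (s + 1) q = 0 := by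
    rw [← h, D, D, D, ← Finset.sum_add_distrib, ← Finset.sum_sub_distrib]
    refine Finset.sum_congr rfl fun i _ => ?_
    ring
  linarith

lemma D_congr {N' : Type} [AddCommGroup N'] [Module R N'] (f : N ≃ₗ[R] N') (s q : ℕ) :
    P.D N s q = P.D N' s q := by
  simp only [D, P.len_congr N f]

lemma D_flat [Module.Flat R N] (s q : ℕ) : P.D N s q = 0 := by
  simp [D, P.len_flat N]

lemma D_zero [IsNoetherianRing R] [IsLocalRing R] {M : Type} [AddCommGroup M] [Module R M]
    [Module.Finite R M] (e : M ≃ₗ[R] P.K 0) (hloc : LocFreePunctured R M) [Module.Finite R N]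
    (s q : ℕ) (hqe : Even q) (e' : M ≃ₗ[R] P.K q) (hN : ClassZeroQ R N) :
    P.D N (s + 1) q = 0 := by
  obtain ⟨n, f, hf⟩ := Module.Finite.exists_fin' R N
  let x : FGIdx R := ⟨n, LinearMap.ker f⟩
  let ex : idxMod R x ≃ₗ[R] N := f.quotKerEquivOfSurjective hf
  have h := hN x ⟨ex⟩
  rw [Submodule.Quotient.mk_eq_zero] at h
  let φ : (FGIdx R →₀ ℚ) →ₗ[ℚ] ℚ :=
    Finsupp.linearCombination ℚ (fun x : FGIdx R => (P.D (idxMod R x) (s + 1) q : ℚ))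
  have hφ : ∀ y : FGIdx R, φ (Finsupp.single y 1) = P.D (idxMod R y) (s + 1) q := by
    intro y
    simp [φ]
  have hle : Submodule.span ℚ (gRelQbar R) ≤ LinearMap.ker φ := by
    rw [Submodule.span_le]
    rintro v (⟨x, y, z, u, w, hu, hw, huw, rfl⟩ | ⟨y, ⟨ey⟩, rfl⟩)
    · rw [SetLike.mem_coe, LinearMap.mem_ker, map_sub, map_sub, hφ, hφ, hφ]
      have := P.D_additive u w hu hw (LinearMap.exact_iff.2 huw.symm) s q hqe
        (P.len_ne_top _ e hloc) (P.len_ne_top _ e hloc) (P.len_ne_top _ e hloc)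
        (P.len_periodic _ e q e') (P.len_periodic _ e q e') (P.len_periodic _ e q e')
      rw [this]
      push_cast
      ring
    · rw [SetLike.mem_coe, LinearMap.mem_ker, hφ, P.D_congr _ ey, P.D_flat]
      simp
  have h0 := hle h
  rw [LinearMap.mem_ker, hφ] at h0
  rw [← P.D_congr _ ex]
  exact_mod_cast h0

end Res
end
end TorRig

theorem q_minus_one_tor_rigid_pair
    (R : Type) [CommRing R] [IsNoetherianRing R] [IsLocalRing R]
    (M : Type) [AddCommGroup M] [Module R M] [Module.Finite R M]
    (q : ℕ) (hq2 : 2 ≤ q) (hqe : Even q)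
    (hper : IsPeriodicSyzygy R M q) (hloc : LocFreePunctured R M)
    (N : Type) [AddCommGroup N] [Module R N] [Module.Finite R N] (hN : ClassZeroQ R N)
    (r : ℕ) (hr : 1 ≤ r)
    (hvan : ∀ i : ℕ, r ≤ i → i ≤ r + q - 2 → Subsingleton (TorM R i M N)) :
    ∀ j : ℕ, r ≤ j → Subsingleton (TorM R j M N) := by
  obtain ⟨P, ⟨e⟩, ⟨e'⟩⟩ := TorRig.exists_res (by omega) hper
  obtain ⟨c, rfl⟩ : ∃ c, r = c + 1 := ⟨r - 1, by omega⟩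
  obtain ⟨m, rfl⟩ : ∃ m, q = m + 1 := ⟨q - 1, by omega⟩
  have hp := P.len_periodic N e (m + 1) e'
  have hz : ∀ i, i < m → P.len N (c + i) = 0 := by
    intro i hi
    rw [P.len_eq N e, Module.length_eq_zero_iff]
    exact hvan _ (by omega) (by omega)
  have hD := P.D_zero N e hloc (c + m) (m + 1) hqe e' hN
  rw [TorRig.Res.D, Finset.sum_range_succ, Finset.sum_eq_zero, zero_add] at hD
  · have hm : P.len N (c + m) = 0 := by
      rw [show c + m + 1 + m = c + m + (m + 1) by ring, hp] at hD
      have h1 : (P.len N (c + m)).toNat = 0 := by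
        rcases mul_eq_zero.1 hD with h | h
        · exact absurd h (pow_ne_zero _ (by norm_num))
        · exact_mod_cast h
      rcases ENat.toNat_eq_zero.1 h1 with h | h
      · exact h
      · exact absurd h (P.len_ne_top N e hloc _)
    have hall : ∀ i, P.len N (c + i) = 0 := by
      intro i
      induction i using Nat.strong_induction_on with
      | _ i ih =>
        rcases lt_trichotomy i m with h | h | h
        · exact hz i h
        · rw [h, hm]
        · obtain ⟨k, rfl⟩ : ∃ k, i = k + (m + 1) := ⟨i - (m + 1), by omega⟩
          rw [← add_assoc, hp]
          exact ih k (by omega)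
    intro j hj
    obtain ⟨k, rfl⟩ : ∃ k, j = c + k + 1 := ⟨j - c - 1, by omega⟩
    have := hall k
    rw [P.len_eq N e, Module.length_eq_zero_iff] at this
    exact this
  · intro i hi
    rw [show c + m + 1 + i = c + i + (m + 1) by ring, hp, hz i (Finset.mem_range.1 hi)]
    simp
end
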